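/- arXiv:2503.17068 — 3 statements merged into one kernel-verified Lean document; each statement's English description precedes it below -/
import Mathlib

section
/- Let F be a field equipped with an absolute value |·|, let f be a binary form of degree d over F, and let ξ ∈ F[c_0, …, c_d] be a homogeneous polynomial of degree q ≥ 1 in the coefficients of degree-d binary forms which is an SL₂-invariant, with ξ(f) ≠ 0. Let C = Σ_m |c_m| be the sum of the absolute values of the coefficients of ξ. Then for every M ∈ SL₂(F) one has max_{0≤i≤d} |coeff(f^M, i)| ≥ (|ξ(f)| / C)^{1/q} > 0. In particular the quantity μ(f) = inf_{M∈SL₂(F)} log max_{0≤i≤d} |coeff(f^M, i)| is bounded below. -/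
/-- The transform `f^M(x,y) = f(ax+by, cx+dy)` of a binary form by a matrix
`M = (a b; c d)`. -/
noncomputable def transform {F : Type*} [CommRing F]
    (M : Matrix (Fin 2) (Fin 2) F) (f : MvPolynomial (Fin 2) F) :
    MvPolynomial (Fin 2) F :=
  MvPolynomial.aeval
    (fun j : Fin 2 => MvPolynomial.C (M j 0) * MvPolynomial.X 0
      + MvPolynomial.C (M j 1) * MvPolynomial.X 1) f

/-- The `i`-th coefficient of a binary form of degree `d`, i.e. the coefficient of
`x^i y^(d-i)`. -/
noncomputable def bcoeff {F : Type*} [CommRing F] (d : ℕ)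
    (f : MvPolynomial (Fin 2) F) (i : Fin (d + 1)) : F :=
  MvPolynomial.coeff (Finsupp.single 0 (i : ℕ) + Finsupp.single 1 (d - (i : ℕ))) f

/-- A homogeneous polynomial of degree `q`, evaluated at a point whose coordinates have absolute
value at most `B`, has absolute value at most `B ^ q` times the sum of the absolute values of its
coefficients. -/
theorem MvPolynomial.IsHomogeneous.absoluteValue_eval_le {F σ : Type*} [CommRing F] [Nontrivial F]
    (v : AbsoluteValue F ℝ) {q : ℕ} {p : MvPolynomial σ F} (hp : p.IsHomogeneous q)
    {x : σ → F} {B : ℝ} (hx : ∀ i, v (x i) ≤ B) :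
    v (MvPolynomial.eval x p) ≤ (∑ m ∈ p.support, v (MvPolynomial.coeff m p)) * B ^ q := by
  rw [MvPolynomial.eval_eq, Finset.sum_mul]
  refine (v.sum_le _ _).trans (Finset.sum_le_sum fun m hm => ?_)
  rw [map_mul]
  refine mul_le_mul_of_nonneg_left ?_ (v.nonneg _)
  have hdeg : ∑ i ∈ m.support, m i = q :=
    (DFunLike.congr_fun Finsupp.degree_eq_weight_one m).trans
      (hp (MvPolynomial.mem_support_iff.mp hm))
  rw [map_prod, ← hdeg, ← Finset.prod_pow_eq_pow_sum]
  refine Finset.prod_le_prod (fun i _ => v.nonneg _) fun i _ => ?_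
  rw [map_pow]
  exact pow_le_pow_left₀ (v.nonneg _) (hx i) _

/-- Let `F` be a field with an absolute value `v`, `f` a binary form of
degree `d` over `F`, and `ξ` a homogeneous `SL₂`-invariant of degree `q ≥ 1` in the
coefficients of degree-`d` binary forms with `ξ(f) ≠ 0`. With `C = Σ_m |c_m|` the sum of
the absolute values of the coefficients of `ξ`, the quantity `(|ξ(f)|/C)^(1/q)` is
strictly positive, for every `M ∈ SL₂(F)` one has
`max_i |coeff(f^M, i)| ≥ (|ξ(f)|/C)^(1/q)`, and in particular
`μ(f) = inf_M log max_i |coeff(f^M, i)|` is bounded below. -/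
theorem stmt_2
    (F : Type*) [Field F] (v : AbsoluteValue F ℝ)
    (d q : ℕ) (hq : 1 ≤ q)
    (f : MvPolynomial (Fin 2) F) (hf : f.IsHomogeneous d)
    (ξ : MvPolynomial (Fin (d + 1)) F) (hξ : ξ.IsHomogeneous q)
    (hinv : ∀ g : MvPolynomial (Fin 2) F, g.IsHomogeneous d →
      ∀ M : Matrix.SpecialLinearGroup (Fin 2) F,
        MvPolynomial.eval (fun s => bcoeff d (transform M.val g) s) ξ
          = MvPolynomial.eval (fun s => bcoeff d g s) ξ)
    (hne : MvPolynomial.eval (fun s => bcoeff d f s) ξ ≠ 0) :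
    0 < (v (MvPolynomial.eval (fun s => bcoeff d f s) ξ)
          / ∑ m ∈ ξ.support, v (MvPolynomial.coeff m ξ)) ^ ((q : ℝ)⁻¹)
    ∧ (∀ M : Matrix.SpecialLinearGroup (Fin 2) F,
        (v (MvPolynomial.eval (fun s => bcoeff d f s) ξ)
            / ∑ m ∈ ξ.support, v (MvPolynomial.coeff m ξ)) ^ ((q : ℝ)⁻¹)
          ≤ Finset.univ.sup' Finset.univ_nonempty
              (fun i : Fin (d + 1) => v (bcoeff d (transform M.val f) i)))
    ∧ BddBelow (Set.range (fun M : Matrix.SpecialLinearGroup (Fin 2) F =>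
        Real.log (Finset.univ.sup' Finset.univ_nonempty
          (fun i : Fin (d + 1) => v (bcoeff d (transform M.val f) i))))) := by
  have hCpos : 0 < ∑ m ∈ ξ.support, v (MvPolynomial.coeff m ξ) := by
    refine Finset.sum_pos (fun m hm => v.pos (MvPolynomial.mem_support_iff.mp hm)) ?_
    rw [Finset.nonempty_iff_ne_empty, Ne, MvPolynomial.support_eq_empty]
    rintro rfl
    exact hne (map_zero _)
  have hpos : 0 < (v (MvPolynomial.eval (fun s => bcoeff d f s) ξ)
      / ∑ m ∈ ξ.support, v (MvPolynomial.coeff m ξ)) ^ ((q : ℝ)⁻¹) :=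
    Real.rpow_pos_of_pos (div_pos (v.pos hne) hCpos) _
  have hbound (M : Matrix.SpecialLinearGroup (Fin 2) F) :
      (v (MvPolynomial.eval (fun s => bcoeff d f s) ξ)
          / ∑ m ∈ ξ.support, v (MvPolynomial.coeff m ξ)) ^ ((q : ℝ)⁻¹)
        ≤ Finset.univ.sup' Finset.univ_nonempty
            (fun i : Fin (d + 1) => v (bcoeff d (transform M.val f) i)) := by
    have hle (i : Fin (d + 1)) : v (bcoeff d (transform M.val f) i)
        ≤ Finset.univ.sup' Finset.univ_nonempty
            (fun i : Fin (d + 1) => v (bcoeff d (transform M.val f) i)) :=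
      Finset.le_sup' (fun i : Fin (d + 1) => v (bcoeff d (transform M.val f) i))
        (Finset.mem_univ i)
    rw [Real.rpow_inv_le_iff_of_pos (div_pos (v.pos hne) hCpos).le
      ((v.nonneg _).trans (hle 0)) (by exact_mod_cast hq), Real.rpow_natCast,
      div_le_iff₀' hCpos, ← hinv f hf M]
    exact hξ.absoluteValue_eval_le v hle
  refine ⟨hpos, hbound, Real.log ((v (MvPolynomial.eval (fun s => bcoeff d f s) ξ)
    / ∑ m ∈ ξ.support, v (MvPolynomial.coeff m ξ)) ^ ((q : ℝ)⁻¹)), ?_⟩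
  rintro _ ⟨M, rfl⟩
  exact Real.log_le_log hpos (hbound M)
end

section
/- Let ξ ∈ ℂ[c_0, …, c_d] be a homogeneous polynomial of degree q ≥ 1 in the coefficients of degree-d binary forms which is an SL₂(ℂ)-invariant. If f is a binary form of degree d over ℂ that is divisible by the m-th power of a linear form with m > d/2, then ξ(f) = 0. In other words, every positive-degree homogeneous SL₂-invariant vanishes on binary forms having a root of multiplicity greater than d/2. -/
theorem coeff_transform_diagonal {F : Type*} [CommRing F] (s t : F)
    (f : MvPolynomial (Fin 2) F) (n : Fin 2 →₀ ℕ) :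
    (transform !![s, 0; 0, t] f).coeff n = s ^ n 0 * t ^ n 1 * f.coeff n := by
  classical
  induction f using MvPolynomial.induction_on' with
  | monomial u a =>
    have h : transform !![s, 0; 0, t] (MvPolynomial.monomial u a)
        = MvPolynomial.monomial u (s ^ u 0 * t ^ u 1 * a) := by
      rw [transform, MvPolynomial.aeval_monomial, MvPolynomial.monomial_eq (s := u),
        Finsupp.prod_fintype _ _ (fun _ => pow_zero _),
        Finsupp.prod_fintype _ _ (fun _ => pow_zero _)]
      simp [Fin.prod_univ_two, mul_pow, MvPolynomial.algebraMap_eq]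
      ring
    rw [h, MvPolynomial.coeff_monomial, MvPolynomial.coeff_monomial]
    split_ifs with hu
    · rw [hu]
    · simp
  | add p q hp hq =>
    rw [transform] at *
    rw [map_add, MvPolynomial.coeff_add, MvPolynomial.coeff_add, hp, hq, mul_add]

theorem isHomogeneous_transform {F : Type*} [CommRing F] (M : Matrix (Fin 2) (Fin 2) F)
    {f : MvPolynomial (Fin 2) F} {d : ℕ} (hf : f.IsHomogeneous d) :
    (transform M f).IsHomogeneous d := by
  rw [transform, ← one_mul d]
  exact hf.aeval _ fun j =>
    (MvPolynomial.isHomogeneous_C_mul_X _ _).add (MvPolynomial.isHomogeneous_C_mul_X _ _)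

theorem exists_eq_of_isHomogeneous_one {F : Type*} [CommRing F]
    {ℓ : MvPolynomial (Fin 2) F} (hℓ : ℓ.IsHomogeneous 1) :
    ∃ α β : F, ℓ = MvPolynomial.C α * MvPolynomial.X 0 + MvPolynomial.C β * MvPolynomial.X 1 := by
  have h := (MvPolynomial.homogeneousSubmodule_one_eq_span_X (σ := Fin 2) (R := F)) ▸
    (MvPolynomial.mem_homogeneousSubmodule 1 ℓ).2 hℓ
  obtain ⟨c, hc⟩ := (Submodule.mem_span_range_iff_exists_fun F).1 h
  exact ⟨c 0, c 1, by rw [← hc]; simp [Fin.sum_univ_two, MvPolynomial.smul_eq_C_mul]⟩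

/-- A nonzero linear form is carried to the first coordinate by a unimodular substitution. -/
theorem exists_transform_eq_X {F : Type*} [Field F] {ℓ : MvPolynomial (Fin 2) F}
    (hℓ : ℓ.IsHomogeneous 1) (hℓ0 : ℓ ≠ 0) :
    ∃ M : Matrix.SpecialLinearGroup (Fin 2) F, transform M.val ℓ = MvPolynomial.X 0 := by
  obtain ⟨α, β, rfl⟩ := exists_eq_of_isHomogeneous_one hℓ
  obtain ⟨a, c, hac⟩ : ∃ a c : F, α * a + β * c = 1 := by
    by_cases hα : α = 0
    · by_cases hβ : β = 0
      · simp [hα, hβ] at hℓ0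
      · exact ⟨0, β⁻¹, by simp [hβ]⟩
    · exact ⟨α⁻¹, 0, by simp [hα]⟩
  refine ⟨⟨!![a, -β; c, α], by rw [Matrix.det_fin_two_of]; linear_combination hac⟩, ?_⟩
  have h := congrArg (MvPolynomial.C (σ := Fin 2)) hac
  simp only [map_add, map_mul, map_one] at h
  simp [transform, MvPolynomial.algebraMap_eq]
  linear_combination (MvPolynomial.X 0) * h

theorem bcoeff_eq_zero_of_X_pow_dvd {F : Type*} [CommRing F] {d m : ℕ}
    {g : MvPolynomial (Fin 2) F} (h : MvPolynomial.X 0 ^ m ∣ g) (i : Fin (d + 1))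
    (hi : (i : ℕ) < m) : bcoeff d g i = 0 := by
  obtain ⟨k, rfl⟩ := h
  rw [MvPolynomial.X_pow_eq_monomial, bcoeff, MvPolynomial.coeff_monomial_mul', if_neg]
  intro hle
  have h0 := hle 0
  simp at h0
  omega

theorem eval_zero_of_isHomogeneous {σ F : Type*} [CommRing F] {ξ : MvPolynomial σ F} {q : ℕ}
    (hξ : ξ.IsHomogeneous q) (hq : q ≠ 0) : MvPolynomial.eval (0 : σ → F) ξ = 0 := by
  rw [MvPolynomial.eval_zero, MvPolynomial.constantCoeff_eq]
  exact hξ.coeff_eq_zero (by simpa using hq.symm)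

/-- Let `ξ` be a homogeneous `SL₂(ℂ)`-invariant of degree `q ≥ 1` in the
coefficients of degree-`d` binary forms. If a degree-`d` binary form `f` over `ℂ` is
divisible by the `m`-th power of a linear form with `m > d/2`, then `ξ(f) = 0`. -/
theorem stmt_4
    (d q : ℕ) (hq : 1 ≤ q)
    (ξ : MvPolynomial (Fin (d + 1)) ℂ) (hξ : ξ.IsHomogeneous q)
    (hinv : ∀ g : MvPolynomial (Fin 2) ℂ, g.IsHomogeneous d →
      ∀ M : Matrix.SpecialLinearGroup (Fin 2) ℂ,
        MvPolynomial.eval (fun s => bcoeff d (transform M.val g) s) ξ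
          = MvPolynomial.eval (fun s => bcoeff d g s) ξ)
    (f : MvPolynomial (Fin 2) ℂ) (hf : f.IsHomogeneous d)
    (ℓ : MvPolynomial (Fin 2) ℂ) (hℓ : ℓ.IsHomogeneous 1) (hℓ0 : ℓ ≠ 0)
    (m : ℕ) (hm : d < 2 * m) (hdvd : ℓ ^ m ∣ f) :
    MvPolynomial.eval (fun s => bcoeff d f s) ξ = 0 := by
  obtain ⟨M, hM⟩ := exists_transform_eq_X hℓ hℓ0
  have hg : (transform M.val f).IsHomogeneous d := isHomogeneous_transform M.val hf
  have hdvd' : MvPolynomial.X 0 ^ m ∣ transform M.val f := by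
    rw [← hM, transform, transform, ← map_pow]
    exact map_dvd _ hdvd
  rw [← hinv f hf M]
  generalize transform M.val f = g at hg hdvd'
  have hlow := bcoeff_eq_zero_of_X_pow_dvd (d := d) hdvd'
  have hscale : ∀ (t : ℂ) (i : Fin (d + 1)), bcoeff d (transform !![t, 0; 0, t⁻¹] g) i
      = t ^ (i : ℕ) * t⁻¹ ^ (d - (i : ℕ)) * bcoeff d g i := by
    intro t i
    rw [bcoeff, coeff_transform_diagonal, bcoeff]
    simp
  set p : ℂ → ℂ := fun t =>
    MvPolynomial.eval (fun i : Fin (d + 1) => t ^ (2 * (i : ℕ) - d) * bcoeff d g i) ξ with hp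
  have hcont : Continuous p := (MvPolynomial.continuous_eval ξ).comp (by fun_prop)
  have hconst : ∀ t : ℂ, t ≠ 0 → p t = MvPolynomial.eval (fun s => bcoeff d g s) ξ := by
    intro t ht
    rw [← hinv g hg ⟨!![t, 0; 0, t⁻¹], by simp [ht]⟩, hp]
    refine congrArg (fun v : Fin (d + 1) → ℂ => MvPolynomial.eval v ξ) (funext fun i => ?_)
    rcases lt_or_ge (i : ℕ) m with hi | hi
    · rw [hscale t i, hlow i hi, mul_zero, mul_zero]
    · have hpow : t ^ (2 * (i : ℕ) - d) = t ^ (i : ℕ) * t⁻¹ ^ (d - (i : ℕ)) := by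
        have hid : 2 * (i : ℕ) - d + (d - (i : ℕ)) = i := by omega
        rw [inv_pow, eq_mul_inv_iff_mul_eq₀ (pow_ne_zero _ ht), ← pow_add, hid]
      rw [hpow, hscale t i]
  have hzero : p 0 = 0 := by
    refine Eq.trans (congrArg (fun v : Fin (d + 1) → ℂ => MvPolynomial.eval v ξ)
      (funext fun i => ?_)) (eval_zero_of_isHomogeneous hξ (by omega))
    rcases lt_or_ge (i : ℕ) m with hi | hi
    · simp [hlow i hi]
    · simp [zero_pow (by omega : 2 * (i : ℕ) - d ≠ 0)]
  rw [← hzero]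
  refine tendsto_nhds_unique (l := nhdsWithin 0 {0}ᶜ) (f := p) ?_
    ((hcont.tendsto 0).mono_left nhdsWithin_le_nhds)
  exact tendsto_const_nhds.congr' (eventually_nhdsWithin_of_forall fun t ht => (hconst t ht).symm)
end

section
/- Let K be a number field, let f be a binary form of degree d over K, and let ξ ∈ K[c_0, …, c_d] be a homogeneous polynomial of degree q ≥ 1 in the coefficients of degree-d binary forms which is an SL₂-invariant, with ξ(f) ≠ 0. For each place ν ∈ M_K set C_ν = Σ_m |c_m|_ν if ν is archimedean and C_ν = max_m |c_m|_ν if ν is non-archimedean, where c_m are the coefficients of ξ (so C_ν = 1 for all but finitely many ν). Then for every M ∈ SL₂(K), Σ_{ν∈M_K} n_ν log max_{0≤i≤d} |coeff(f^M, i)|_ν ≥ −(1/q) Σ_{ν∈M_K} n_ν log C_ν. In particular the logarithmic naive height of forms in the SL₂(K)-orbit of f is bounded below by a constant depending only on ξ, so the global naive height of a semistable binary form is finite. -/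
open Classical

lemma abv_monomial_le {K ι : Type*} [Field K] [Fintype ι] (a : AbsoluteValue K ℝ)
    {x : ι → K} {H : ℝ} (hx : ∀ i, a (x i) ≤ H) (m : ι →₀ ℕ) :
    a (∏ i, x i ^ m i) ≤ H ^ m.degree := by
  rw [map_prod, Finsupp.degree_eq_sum, ← Finset.prod_pow_eq_pow_sum]
  refine Finset.prod_le_prod (fun i _ => a.nonneg _) fun i _ => ?_
  rw [map_pow]
  exact pow_le_pow_left₀ (a.nonneg _) (hx i) _

lemma abv_term_le {K ι : Type*} [Field K] [Fintype ι] (a : AbsoluteValue K ℝ)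
    {p : MvPolynomial ι K} {q : ℕ} (hp : p.IsHomogeneous q)
    {x : ι → K} {H : ℝ} (hx : ∀ i, a (x i) ≤ H) {m : ι →₀ ℕ} (hm : m ∈ p.support) :
    a (p.coeff m * ∏ i, x i ^ m i) ≤ a (p.coeff m) * H ^ q := by
  have hdeg : m.degree = q := by
    rw [Finsupp.degree_eq_weight_one]
    exact hp (MvPolynomial.mem_support_iff.mp hm)
  rw [map_mul, ← hdeg]
  exact mul_le_mul_of_nonneg_left (abv_monomial_le a hx m) (a.nonneg _)

lemma abv_eval_le_sum_mul_pow {K ι : Type*} [Field K] [Fintype ι] (a : AbsoluteValue K ℝ)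
    {p : MvPolynomial ι K} {q : ℕ} (hp : p.IsHomogeneous q)
    {x : ι → K} {H : ℝ} (hx : ∀ i, a (x i) ≤ H) :
    a (MvPolynomial.eval x p) ≤ (∑ m ∈ p.support, a (p.coeff m)) * H ^ q := by
  rw [MvPolynomial.eval_eq', Finset.sum_mul]
  exact (a.sum_le _ _).trans (Finset.sum_le_sum fun m hm => abv_term_le a hp hx hm)

lemma abv_sum_le_of_nonarchimedean {K ι : Type*} [Field K] (a : AbsoluteValue K ℝ)
    (ha : ∀ x y, a (x + y) ≤ max (a x) (a y)) {s : Finset ι} {g : ι → K} {B : ℝ}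
    (hB : 0 ≤ B) (hg : ∀ i ∈ s, a (g i) ≤ B) : a (∑ i ∈ s, g i) ≤ B :=
  Finset.sum_induction g (fun y => a y ≤ B)
    (fun x y hx hy => (ha x y).trans (max_le hx hy)) (by simpa using hB) hg

lemma abv_eval_le_sup_mul_pow {K ι : Type*} [Field K] [Fintype ι] (a : AbsoluteValue K ℝ)
    (ha : ∀ x y, a (x + y) ≤ max (a x) (a y))
    {p : MvPolynomial ι K} {q : ℕ} (hp : p.IsHomogeneous q)
    {x : ι → K} {H C : ℝ} (hH : 0 ≤ H) (hx : ∀ i, a (x i) ≤ H)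
    (hC : 0 ≤ C) (hpC : ∀ m ∈ p.support, a (p.coeff m) ≤ C) :
    a (MvPolynomial.eval x p) ≤ C * H ^ q := by
  rw [MvPolynomial.eval_eq']
  exact abv_sum_le_of_nonarchimedean a ha (by positivity) fun m hm =>
    (abv_term_le a hp hx hm).trans (mul_le_mul_of_nonneg_right (hpC m hm) (by positivity))

lemma exists_ne_zero_of_isHomogeneous_eval_ne_zero {K ι : Type*} [Field K]
    {p : MvPolynomial ι K} {q : ℕ} (hq : q ≠ 0) (hp : p.IsHomogeneous q)
    {x : ι → K} (hx : MvPolynomial.eval x p ≠ 0) : ∃ i, x i ≠ 0 := by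
  by_contra! h
  obtain rfl : x = 0 := funext h
  refine hx ?_
  rw [MvPolynomial.eval_zero, MvPolynomial.constantCoeff_eq]
  exact hp.coeff_eq_zero (by simpa using hq.symm)

/-- For nonzero `x`, the logarithmic absolute values of `x` add up to zero. -/
lemma finsum_mul_log_abv_eq_zero {K V : Type*} [Field K] (absv : V → AbsoluteValue K ℝ)
    (n : V → ℕ) {x : K} (hx : x ≠ 0) (hfin : {v | absv v x ≠ 1}.Finite)
    (hprod : ∏ᶠ v, absv v x ^ n v = 1) :
    ∑ᶠ v, (n v : ℝ) * Real.log (absv v x) = 0 := by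
  have hsub : (Function.mulSupport fun v => absv v x ^ n v) ⊆ hfin.toFinset := by
    intro v hv
    simp only [Set.Finite.coe_toFinset, Set.mem_ofPred_eq]
    rintro h
    simp [h] at hv
  have hsub' : (Function.support fun v => (n v : ℝ) * Real.log (absv v x)) ⊆
      hfin.toFinset := by
    intro v hv
    simp only [Set.Finite.coe_toFinset, Set.mem_ofPred_eq]
    rintro h
    simp [h] at hv
  rw [finprod_eq_prod_of_mulSupport_subset _ hsub] at hprod
  rw [finsum_eq_sum_of_support_subset _ hsub']
  simp_rw [← Real.log_pow]
  rw [← Real.log_prod fun v _ => pow_ne_zero _ ((absv v).ne_zero hx), hprod, Real.log_one]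

/-- Let `K` be a number field with places indexed by `V`, normalized
absolute values and local degrees satisfying the product formula, finitely many
archimedean places and the ultrametric inequality at the non-archimedean ones. Let `f`
be a binary form of degree `d` over `K` and `ξ` a homogeneous `SL₂`-invariant of degree
`q ≥ 1` with `ξ(f) ≠ 0`. With `C_ν = Σ_m |c_m|_ν` at archimedean `ν` and
`C_ν = max_m |c_m|_ν` at non-archimedean `ν`, for every `M ∈ SL₂(K)` one has
`Σ_ν n_ν log max_i |coeff(f^M, i)|_ν ≥ −(1/q) Σ_ν n_ν log C_ν`; in particular the
logarithmic naive height on the `SL₂(K)`-orbit of `f` is bounded below by a constant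
depending only on `ξ`. -/
theorem stmt_12
    (K : Type*) [Field K] [NumberField K]
    (V : Type*) (absv : V → AbsoluteValue K ℝ) (n : V → ℕ)
    (arch : V → Prop) [DecidablePred arch]
    (harchfin : {v | arch v}.Finite)
    (hnonarch : ∀ v, ¬ arch v → ∀ x y : K,
      absv v (x + y) ≤ max (absv v x) (absv v y))
    (hfin : ∀ x : K, x ≠ 0 → {v | absv v x ≠ 1}.Finite)
    (hprod : ∀ x : K, x ≠ 0 → ∏ᶠ v, absv v x ^ n v = 1)
    (d q : ℕ) (hq : 1 ≤ q)
    (f : MvPolynomial (Fin 2) K) (hf : f.IsHomogeneous d)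
    (ξ : MvPolynomial (Fin (d + 1)) K) (hξ : ξ.IsHomogeneous q)
    (hinv : ∀ g : MvPolynomial (Fin 2) K, g.IsHomogeneous d →
      ∀ M : Matrix.SpecialLinearGroup (Fin 2) K,
        MvPolynomial.eval (fun s => bcoeff d (transform M.val g) s) ξ
          = MvPolynomial.eval (fun s => bcoeff d g s) ξ)
    (hne : MvPolynomial.eval (fun s => bcoeff d f s) ξ ≠ 0) :
    ∀ M : Matrix.SpecialLinearGroup (Fin 2) K,
      -((q : ℝ)⁻¹ * ∑ᶠ v, (n v : ℝ) *
          Real.log (if arch v then ∑ m ∈ ξ.support, absv v (MvPolynomial.coeff m ξ)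
            else ((ξ.support.sup (fun m =>
              (⟨absv v (MvPolynomial.coeff m ξ), (absv v).nonneg _⟩ : NNReal)) : NNReal) : ℝ)))
        ≤ ∑ᶠ v, (n v : ℝ) *
            Real.log (Finset.univ.sup' Finset.univ_nonempty
              (fun i : Fin (d + 1) => absv v (bcoeff d (transform M.val f) i))) := by
  intro M
  set x : Fin (d + 1) → K := fun i => bcoeff d (transform M.val f) i with hxdef
  have hα : MvPolynomial.eval x ξ ≠ 0 := by rwa [hxdef, hinv f hf M]
  set C : V → ℝ := fun v =>
    if arch v then ∑ m ∈ ξ.support, absv v (MvPolynomial.coeff m ξ)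
    else ((ξ.support.sup (fun m =>
      (⟨absv v (MvPolynomial.coeff m ξ), (absv v).nonneg _⟩ : NNReal)) : NNReal) : ℝ) with hC
  set H : V → ℝ := fun v =>
    Finset.univ.sup' Finset.univ_nonempty (fun i : Fin (d + 1) => absv v (x i)) with hH
  change -((q : ℝ)⁻¹ * ∑ᶠ v, (n v : ℝ) * Real.log (C v)) ≤ ∑ᶠ v, (n v : ℝ) * Real.log (H v)
  obtain ⟨i₀, hi₀⟩ := exists_ne_zero_of_isHomogeneous_eval_ne_zero (by omega) hξ hα
  have hxH : ∀ v i, absv v (x i) ≤ H v := fun v i =>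
    Finset.le_sup' (fun i => absv v (x i)) (Finset.mem_univ i)
  have hHpos : ∀ v, 0 < H v := fun v => ((absv v).pos hi₀).trans_le (hxH v i₀)
  have hC0 : ∀ v, 0 ≤ C v := fun v => by
    simp only [hC]
    split_ifs
    · exact Finset.sum_nonneg fun m _ => (absv v).nonneg _
    · exact NNReal.coe_nonneg _
  have hbound : ∀ v, absv v (MvPolynomial.eval x ξ) ≤ C v * H v ^ q := fun v => by
    by_cases hv : arch v
    · simpa only [hC, if_pos hv] using abv_eval_le_sum_mul_pow (absv v) hξ (hxH v)
    · refine abv_eval_le_sup_mul_pow (absv v) (hnonarch v hv) hξ (hHpos v).le (hxH v)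
        (hC0 v) fun m hm => ?_
      simp only [hC, if_neg hv]
      exact NNReal.coe_le_coe.mpr (Finset.le_sup (f := fun m =>
        (⟨absv v (MvPolynomial.coeff m ξ), (absv v).nonneg _⟩ : NNReal)) hm)
  have hCpos : ∀ v, 0 < C v := fun v =>
    pos_of_mul_pos_left (((absv v).pos hα).trans_le (hbound v)) (pow_nonneg (hHpos v).le q)
  have hξ0 : ξ.support.Nonempty := by
    rw [Finset.nonempty_iff_ne_empty, Ne, MvPolynomial.support_eq_empty]
    rintro rfl
    simp at hα
  have hCfin : (Function.support fun v => (n v : ℝ) * Real.log (C v)).Finite := by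
    refine (harchfin.union (ξ.support.finite_toSet.biUnion fun m hm =>
      hfin _ (MvPolynomial.mem_support_iff.mp hm))).subset fun v hv => ?_
    by_contra hv'
    simp only [Set.mem_union, Set.mem_iUnion, Set.mem_ofPred_eq, not_or, not_exists,
      not_not] at hv'
    refine hv ?_
    have hC1 : C v = 1 := by
      simp only [hC, if_neg hv'.1]
      refine congrArg NNReal.toReal
        ((Finset.sup_congr rfl fun m hm => ?_).trans (Finset.sup_const hξ0 (1 : NNReal)))
      exact NNReal.eq ((hv'.2 m hm).trans NNReal.coe_one.symm)
    simp [hC1]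
  have hHfin : (Function.support fun v => (n v : ℝ) * Real.log (H v)).Finite := by
    refine ((Set.toFinite {i | x i ≠ 0}).biUnion fun i hi => hfin (x i) hi).subset
      fun v hv => ?_
    by_contra hv'
    simp only [Set.mem_iUnion, Set.mem_ofPred_eq, not_exists, not_not] at hv'
    refine hv ?_
    have hH1 : H v = 1 := by
      refine le_antisymm (Finset.sup'_le _ _ fun i _ => ?_) ((hv' i₀ hi₀).ge.trans (hxH v i₀))
      by_cases hi : x i = 0
      · simp [hi]
      · exact (hv' i hi).le
    simp [hH1]
  have hαfin : (Function.support fun v =>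
      (n v : ℝ) * Real.log (absv v (MvPolynomial.eval x ξ))).Finite := by
    refine (hfin _ hα).subset fun v hv h => hv ?_
    simp [h]
  have hle : ∑ᶠ v, (n v : ℝ) * Real.log (absv v (MvPolynomial.eval x ξ)) ≤
      ∑ᶠ v, ((n v : ℝ) * Real.log (C v) + (q : ℝ) * ((n v : ℝ) * Real.log (H v))) := by
    refine finsum_le_finsum' hαfin ?_ fun v => ?_
    · refine (hCfin.union hHfin).subset fun v hv => ?_
      by_contra hv'
      simp only [Set.mem_union, Function.mem_support, not_or, not_not] at hv'
      exact hv (by simp only [hv'.1, hv'.2, mul_zero, add_zero])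
    · have hlog := Real.log_le_log ((absv v).pos hα) (hbound v)
      rw [Real.log_mul (hCpos v).ne' (pow_ne_zero q (hHpos v).ne'), Real.log_pow] at hlog
      linarith [mul_le_mul_of_nonneg_left hlog (n v).cast_nonneg]
  rw [finsum_mul_log_abv_eq_zero absv n hα (hfin _ hα) (hprod _ hα),
    finsum_add_distrib hCfin (hHfin.subset fun v hv h => hv (by simp [h])),
    ← mul_finsum' _ _ hHfin] at hle
  have hq0 : (0 : ℝ) < q := by exact_mod_cast hq
  rw [neg_le_iff_add_nonneg, ← mul_le_mul_iff_right₀ hq0, mul_zero, mul_add,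
    mul_inv_cancel_left₀ hq0.ne']
  linarith
end
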